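/- Data-processing bound for wired distributions (core estimate of Lemma 3): Let A, B, C, Y be finite sets. For each y ∈ Y let q(·|y) be a probability distribution on B; for each β ∈ B let p(·|β) and p'(·|β) be probability distributions on A with p'(α|β) = 0 implying p(α|β) = 0; and for each (α, β, y) let r(·|α,β,y) be a probability distribution on C. Then for every y ∈ Y, S_d( Σ_{α,β} r(·|α,β,y) p(α|β) q(β|y) || Σ_{α,β} r(·|α,β,y) p'(α|β) q(β|y) ) ≤ max_{β ∈ B} S_d( p(·|β) || p'(·|β) ). -/

import Mathlib

open scoped BigOperators

/-- Relative entropy (Kullback–Leibler divergence) of two probability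
distributions on a finite type, `S_d(p‖q) = Σ_i p i · log (p i / q i)`
(with the convention `0 · log (0/c) = 0`, automatic since `0 * x = 0`). -/
noncomputable def relEntD {ι : Type*} [Fintype ι] (p q : ι → ℝ) : ℝ :=
  ∑ i, p i * Real.log (p i / q i)

/-- Tangent-line bound for `a * log (a / b)` at slope parameter `t`. -/
lemma mul_log_tangent_le {a b t : ℝ} (ha : 0 ≤ a) (hb : 0 ≤ b) (hab : b = 0 → a = 0)
    (ht : 0 < t) : a * Real.log t + a - t * b ≤ a * Real.log (a / b) := by
  rcases ha.eq_or_lt with rfl | ha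
  · simpa using mul_nonneg ht.le hb
  have hb : 0 < b := hb.lt_of_ne fun h => ha.ne' (hab h.symm)
  have h := mul_le_mul_of_nonneg_left
    (Real.log_le_sub_one_of_pos (show 0 < t * b / a by positivity)) ha.le
  rw [Real.log_div (by positivity) ha.ne', Real.log_mul ht.ne' hb.ne', mul_sub a _ 1,
    mul_div_cancel₀ _ ha.ne'] at h
  rw [Real.log_div ha.ne' hb.ne']
  linarith

/-- The log-sum inequality. -/
lemma sum_mul_log_sum_div_sum_le {ι : Type*} [Fintype ι] (a b : ι → ℝ) (ha : ∀ i, 0 ≤ a i)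
    (hb : ∀ i, 0 ≤ b i) (hab : ∀ i, b i = 0 → a i = 0) :
    (∑ i, a i) * Real.log ((∑ i, a i) / ∑ i, b i) ≤ relEntD a b := by
  unfold relEntD
  have hS : 0 ≤ ∑ i, a i := Finset.sum_nonneg fun i _ => ha i
  have hT : 0 ≤ ∑ i, b i := Finset.sum_nonneg fun i _ => hb i
  rcases hS.eq_or_lt with h | hS
  · have h0 : ∀ i, a i = 0 := fun i =>
      (Finset.sum_eq_zero_iff_of_nonneg fun i _ => ha i).1 h.symm i (Finset.mem_univ i)
    simp [h0]
  have hT : 0 < ∑ i, b i := by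
    refine hT.lt_of_ne fun h => hS.ne' (Finset.sum_eq_zero fun i _ => hab i ?_)
    exact (Finset.sum_eq_zero_iff_of_nonneg fun i _ => hb i).1 h.symm i (Finset.mem_univ i)
  have key := Finset.sum_le_sum fun i (_ : i ∈ Finset.univ) =>
    mul_log_tangent_le (ha i) (hb i) (hab i) (div_pos hS hT)
  rw [Finset.sum_sub_distrib, Finset.sum_add_distrib, ← Finset.sum_mul, ← Finset.mul_sum,
    div_mul_cancel₀ _ hT.ne'] at key
  linarith

/-- **Data-processing bound for wired distributions (core estimate of
Lemma 3).**  Let `A, B, C, Y` be finite sets.  For each `y ∈ Y` let `q(·|y)`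
be a probability distribution on `B`; for each `β ∈ B` let `p(·|β)` and
`p'(·|β)` be probability distributions on `A` with `p'(α|β) = 0` implying
`p(α|β) = 0`; and for each `(α,β,y)` let `r(·|α,β,y)` be a probability
distribution on `C`.  Then for every `y ∈ Y`,
`S_d(Σ_{α,β} r(·|α,β,y) p(α|β) q(β|y) ‖ Σ_{α,β} r(·|α,β,y) p'(α|β) q(β|y))
  ≤ max_{β ∈ B} S_d(p(·|β) ‖ p'(·|β))`. -/
theorem data_processing_bound
    {A B C Y : Type*} [Fintype A] [Fintype B] [Fintype C] [Fintype Y]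
    (q : Y → B → ℝ) (p p' : B → A → ℝ) (r : A → B → Y → C → ℝ)
    (hq : ∀ y, (∀ β, 0 ≤ q y β) ∧ (∑ β, q y β) = 1)
    (hp : ∀ β, (∀ α, 0 ≤ p β α) ∧ (∑ α, p β α) = 1)
    (hp' : ∀ β, (∀ α, 0 ≤ p' β α) ∧ (∑ α, p' β α) = 1)
    (habs : ∀ β α, p' β α = 0 → p β α = 0)
    (hr : ∀ α β y, (∀ γ, 0 ≤ r α β y γ) ∧ (∑ γ, r α β y γ) = 1)
    (y : Y) :
    relEntD (fun γ => ∑ α, ∑ β, r α β y γ * p β α * q y β)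
            (fun γ => ∑ α, ∑ β, r α β y γ * p' β α * q y β)
      ≤ ⨆ β : B, relEntD (p β) (p' β) := by
  have hlog (γ : C) :
      (∑ α, ∑ β, r α β y γ * p β α * q y β) *
        Real.log ((∑ α, ∑ β, r α β y γ * p β α * q y β) /
          ∑ α, ∑ β, r α β y γ * p' β α * q y β) ≤
      ∑ α, ∑ β, r α β y γ * (q y β * (p β α * Real.log (p β α / p' β α))) := by
    simp only [← Fintype.sum_prod_type']
    refine (sum_mul_log_sum_div_sum_le _ _
      (fun x => mul_nonneg (mul_nonneg ((hr _ _ _).1 _) ((hp _).1 _)) ((hq _).1 _))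
      (fun x => mul_nonneg (mul_nonneg ((hr _ _ _).1 _) ((hp' _).1 _)) ((hq _).1 _))
      fun x hx => ?_).trans (Finset.sum_le_sum fun x _ => ?_)
    · rcases mul_eq_zero.1 hx with h | h
      · rcases mul_eq_zero.1 h with h | h
        · simp [h]
        · simp [habs _ _ h]
      · simp [h]
    · by_cases h₁ : r x.1 x.2 y γ = 0
      · simp [h₁]
      by_cases h₂ : q y x.2 = 0
      · simp [h₂]
      rw [mul_div_mul_right _ _ h₂, mul_div_mul_left _ _ h₁]
      exact le_of_eq (by ring)
  calc
    _ ≤ ∑ γ, ∑ α, ∑ β, r α β y γ * (q y β * (p β α * Real.log (p β α / p' β α))) :=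
      Finset.sum_le_sum fun γ _ => hlog γ
    _ = ∑ α, ∑ β, q y β * (p β α * Real.log (p β α / p' β α)) := by
      rw [Finset.sum_comm]
      refine Finset.sum_congr rfl fun α _ => ?_
      rw [Finset.sum_comm]
      refine Finset.sum_congr rfl fun β _ => ?_
      rw [← Finset.sum_mul, (hr α β y).2, one_mul]
    _ = ∑ β, q y β * relEntD (p β) (p' β) := by
      rw [Finset.sum_comm]
      simp only [relEntD, Finset.mul_sum]
    _ ≤ ∑ β, q y β * ⨆ β : B, relEntD (p β) (p' β) :=
      Finset.sum_le_sum fun β _ => mul_le_mul_of_nonneg_left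
        (le_ciSup (f := fun β => relEntD (p β) (p' β)) (Set.finite_range _).bddAbove β)
        ((hq y).1 β)
    _ = ⨆ β : B, relEntD (p β) (p' β) := by
      rw [← Finset.sum_mul, (hq y).2, one_mul]
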